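/- Let G be a finite group. Then the Chermak–Delgado measure m_G is increasing on the centralizer lattice C(G) (i.e., for all C, D ∈ C(G) with C ≤ D one has m_G(C) ≤ m_G(D)) if and only if G is nilpotent and every Sylow subgroup P of G satisfies C(P) = CD(P). -/

import Mathlib

/-- The Chermak–Delgado measure of a subgroup `H` of `G`: `|H| * |C_G(H)|`. -/
noncomputable def cdMeasure (G : Type*) [Group G] (H : Subgroup G) : ℕ :=
  Nat.card H * Nat.card (Subgroup.centralizer (H : Set G))

/-- The Chermak–Delgado lattice of `G`: subgroups of maximal Chermak–Delgado measure. -/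
def cdLattice (G : Type*) [Group G] : Set (Subgroup G) :=
  {H | ∀ K : Subgroup G, cdMeasure G K ≤ cdMeasure G H}

/-- The centralizer lattice of `G`: subgroups that are centralizers of subgroups. -/
def centLattice (G : Type*) [Group G] : Set (Subgroup G) :=
  {C | ∃ H : Subgroup G, C = Subgroup.centralizer (H : Set G)}

open Subgroup

section General

variable {G : Type*} [Group G]

theorem cdMeasure_map_mulEquiv {G' : Type*} [Group G'] (e : G ≃* G') (H : Subgroup G) :
    cdMeasure G' (H.map e.toMonoidHom) = cdMeasure G H := by
  have hc : centralizer (H.map e.toMonoidHom : Set G') =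
      (centralizer (H : Set G)).map e.toMonoidHom := by
    ext x
    obtain ⟨y, rfl⟩ := e.surjective x
    simp [mem_centralizer_iff, ← map_mul]
  unfold cdMeasure
  rw [hc, card_map_of_injective e.injective, card_map_of_injective e.injective]

theorem map_mem_cdLattice {G' : Type*} [Group G'] (e : G ≃* G') {H : Subgroup G}
    (hH : H ∈ cdLattice G) : H.map e.toMonoidHom ∈ cdLattice G' := fun K => by
  rw [cdMeasure_map_mulEquiv, ← cdMeasure_map_mulEquiv e.symm K]
  exact hH _

theorem le_centralizer_centralizer (H : Subgroup G) :
    H ≤ centralizer (centralizer (H : Set G) : Set G) :=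
  le_centralizer_iff.1 le_rfl

theorem centralizer_centralizer_centralizer (H : Subgroup G) :
    centralizer (centralizer (centralizer (H : Set G) : Set G) : Set G) =
      centralizer (H : Set G) :=
  le_antisymm (centralizer_le (le_centralizer_centralizer H)) (le_centralizer_centralizer _)

theorem cdMeasure_centralizer_centralizer (H : Subgroup G) :
    cdMeasure G (centralizer (centralizer (H : Set G) : Set G)) =
      cdMeasure G (centralizer (H : Set G)) := by
  unfold cdMeasure
  rw [centralizer_centralizer_centralizer, mul_comm]

theorem top_mem_centLattice : (⊤ : Subgroup G) ∈ centLattice G :=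
  ⟨⊥, by
    rw [eq_comm, centralizer_eq_top_iff_subset]
    simp⟩

/-- The Chermak–Delgado measure is constant on the centralizer lattice. -/
def CDMeasureConst (G : Type*) [Group G] : Prop :=
  ∀ H : Subgroup G, cdMeasure G (centralizer (H : Set G)) = cdMeasure G ⊤

theorem CDMeasureConst.of_mulEquiv {G' : Type*} [Group G'] (e : G ≃* G')
    (h : CDMeasureConst G) : CDMeasureConst G' := fun H => by
  have hc : centralizer (H : Set G') =
      (centralizer (H.map e.symm.toMonoidHom : Set G)).map e.toMonoidHom := by
    ext x
    obtain ⟨y, rfl⟩ := e.surjective x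
    simp only [mem_centralizer_iff, SetLike.mem_coe, mem_map, forall_exists_index, and_imp,
      forall_apply_eq_imp_iff₂, MulEquiv.toMonoidHom_eq_coe, MonoidHom.coe_coe,
      EmbeddingLike.apply_eq_iff_eq, exists_eq_right]
    refine forall₂_congr fun a _ => ?_
    rw [← e.injective.eq_iff]
    simp
  rw [hc, cdMeasure_map_mulEquiv, h, ← cdMeasure_map_mulEquiv e,
    map_top_of_surjective _ e.surjective]

theorem cdMeasureConst_congr {G' : Type*} [Group G'] (e : G ≃* G') :
    CDMeasureConst G ↔ CDMeasureConst G' :=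
  ⟨.of_mulEquiv e, .of_mulEquiv e.symm⟩

theorem CDMeasureConst.of_subsingleton [Subsingleton G] : CDMeasureConst G := fun _ =>
  congrArg _ (Subsingleton.elim _ _)

theorem relIndex_eq_ncard_orbit (H K : Subgroup G) :
    K.relIndex H = (MulAction.orbit H ((1 : G) : G ⧸ K)).ncard := by
  rw [← MulAction.index_stabilizer, relIndex]
  congr 1
  ext h
  rw [MulAction.mem_stabilizer_iff, mem_subgroupOf, eq_comm (b := ((1 : G) : G ⧸ K))]
  change _ ↔ ((1 : G) : G ⧸ K) = (((h : G) * 1 : G) : G ⧸ K)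
  rw [QuotientGroup.eq]
  simp

theorem card_inf_mul_relIndex (H K : Subgroup G) :
    Nat.card (H ⊓ K : Subgroup G) * K.relIndex H = Nat.card H := by
  rw [← inf_relIndex_left, ← relIndex_bot_left, ← relIndex_bot_left,
    relIndex_mul_relIndex _ _ _ bot_le inf_le_left]

theorem centralizer_sup (H K : Subgroup G) :
    centralizer ((H ⊔ K : Subgroup G) : Set G) =
      centralizer (H : Set G) ⊓ centralizer (K : Set G) := by
  refine le_antisymm (le_inf (centralizer_le ?_) (centralizer_le ?_)) ?_
  · exact le_sup_left (a := H)
  · exact le_sup_right (a := H)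
  · rw [le_centralizer_iff, sup_le_iff]
    exact ⟨le_centralizer_iff.1 inf_le_left, le_centralizer_iff.1 inf_le_right⟩

theorem isMulCommutative_centralizer_centralizer (H : Subgroup G) [IsMulCommutative H] :
    IsMulCommutative (centralizer (centralizer (H : Set G) : Set G)) := by
  rw [← le_centralizer_iff_isMulCommutative, centralizer_centralizer_centralizer]
  exact centralizer_le H.le_centralizer

theorem relIndex_ne_zero_of_finite [Finite G] (H K : Subgroup G) : H.relIndex K ≠ 0 :=
  index_ne_zero_of_finite

variable [Finite G]

theorem cdMeasure_le_cdMeasure_centralizer (H : Subgroup G) :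
    cdMeasure G H ≤ cdMeasure G (centralizer (H : Set G)) := by
  unfold cdMeasure
  rw [mul_comm]
  exact Nat.mul_le_mul_left _ (card_le_of_le (le_centralizer_centralizer H))

theorem cdLattice_subset_centLattice : cdLattice G ⊆ centLattice G := fun H hH => by
  refine ⟨centralizer (H : Set G), eq_of_le_of_card_ge (le_centralizer_centralizer H) ?_⟩
  have h := hH (centralizer (H : Set G))
  unfold cdMeasure at h
  rw [mul_comm] at h
  exact Nat.le_of_mul_le_mul_right h Nat.card_pos

theorem cdMeasureConst_iff_centLattice_eq_cdLattice :
    CDMeasureConst G ↔ centLattice G = cdLattice G := by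
  constructor
  · intro h
    refine Set.Subset.antisymm ?_ cdLattice_subset_centLattice
    rintro _ ⟨H, rfl⟩ K
    rw [h H, ← h K]
    exact cdMeasure_le_cdMeasure_centralizer K
  · intro h H
    have h₁ : centralizer (H : Set G) ∈ cdLattice G := h ▸ ⟨H, rfl⟩
    have h₂ : ⊤ ∈ cdLattice G := h ▸ top_mem_centLattice
    exact le_antisymm (h₂ _) (h₁ _)

theorem cdMeasureConst_iff_monotoneOn_centLattice :
    CDMeasureConst G ↔ ∀ C D : Subgroup G, C ∈ centLattice G → D ∈ centLattice G → C ≤ D →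
      cdMeasure G C ≤ cdMeasure G D := by
  constructor
  · rintro h _ _ ⟨H, rfl⟩ ⟨K, rfl⟩ -
    rw [h, h]
  · intro h H
    refine le_antisymm (h _ _ ⟨H, rfl⟩ top_mem_centLattice le_top) ?_
    have hZ : centralizer ((⊤ : Subgroup G) : Set G) ≤
        centralizer (centralizer (H : Set G) : Set G) :=
      centralizer_le (Set.subset_univ _)
    have h₁ := h _ _ ⟨_, rfl⟩ ⟨_, rfl⟩ hZ
    rw [cdMeasure_centralizer_centralizer] at h₁
    exact (cdMeasure_le_cdMeasure_centralizer ⊤).trans h₁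

theorem exists_inv_mul_mem_of_relIndex_le {H K L : Subgroup G} (hHL : H ≤ L)
    (h : K.relIndex L ≤ K.relIndex H) {l : G} (hl : l ∈ L) : ∃ x ∈ H, x⁻¹ * l ∈ K := by
  rw [relIndex_eq_ncard_orbit, relIndex_eq_ncard_orbit] at h
  have hsub : MulAction.orbit H ((1 : G) : G ⧸ K) ⊆ MulAction.orbit L ((1 : G) : G ⧸ K) := by
    rintro _ ⟨x, rfl⟩
    exact ⟨⟨x, hHL x.2⟩, rfl⟩
  have hmem : (((l : G) * 1 : G) : G ⧸ K) ∈ MulAction.orbit H ((1 : G) : G ⧸ K) := by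
    rw [Set.eq_of_subset_of_ncard_le hsub h (Set.toFinite _)]
    exact ⟨⟨l, hl⟩, rfl⟩
  obtain ⟨x, hx⟩ := hmem
  refine ⟨x, x.2, ?_⟩
  change (((x : G) * 1 : G) : G ⧸ K) = _ at hx
  rw [QuotientGroup.eq] at hx
  simpa using hx

theorem sup_mem_cdLattice_and_relIndex_sup_le {H K : Subgroup G} (hH : H ∈ cdLattice G)
    (hK : K ∈ cdLattice G) :
    H ⊔ K ∈ cdLattice G ∧ K.relIndex (H ⊔ K) ≤ K.relIndex H := by
  set CH := centralizer (H : Set G) with hCH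
  set CK := centralizer (K : Set G) with hCK
  set CS := centralizer ((H ⊔ K : Subgroup G) : Set G) with hCS
  set CI := centralizer ((H ⊓ K : Subgroup G) : Set G) with hCI
  have e₁ := card_inf_mul_relIndex H K
  have e₂ : Nat.card CS * CK.relIndex CH = Nat.card CH := by
    rw [hCS, centralizer_sup]; exact card_inf_mul_relIndex _ _
  have e₃ : Nat.card K * K.relIndex (H ⊔ K) = Nat.card (H ⊔ K : Subgroup G) := by
    have := card_inf_mul_relIndex (H ⊔ K) K
    rwa [inf_eq_right.2 le_sup_right] at this
  have hCHI : CH ≤ CI := centralizer_le (inf_le_left (a := H) (b := K))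
  have hCKI : CK ≤ CI := centralizer_le (inf_le_right (a := H) (b := K))
  have e₄ : Nat.card CK * CK.relIndex CI = Nat.card CI := by
    have := card_inf_mul_relIndex CI CK
    rwa [inf_eq_right.2 hCKI] at this
  have l₁ : CK.relIndex CH ≤ CK.relIndex CI :=
    relIndex_le_of_le_right hCHI (relIndex_ne_zero_of_finite _ _)
  have l₂ : K.relIndex H ≤ K.relIndex (H ⊔ K) :=
    relIndex_le_of_le_right le_sup_left (relIndex_ne_zero_of_finite _ _)
  have m₁ : Nat.card (H ⊓ K : Subgroup G) * Nat.card CI ≤ Nat.card H * Nat.card CH :=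
    hH (H ⊓ K)
  have m₂ : Nat.card (H ⊔ K : Subgroup G) * Nat.card CS ≤ Nat.card K * Nat.card CK :=
    hK (H ⊔ K)
  have pI : 0 < Nat.card (H ⊓ K : Subgroup G) := Nat.card_pos
  have pK : 0 < Nat.card K := Nat.card_pos
  have pCS : 0 < Nat.card CS := Nat.card_pos
  have pc : 0 < CK.relIndex CH := Nat.pos_of_ne_zero (relIndex_ne_zero_of_finite _ _)
  have k₁ : Nat.card CK ≤ K.relIndex H * Nat.card CS := by
    refine Nat.le_of_mul_le_mul_left ?_ (Nat.mul_pos pI pc)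
    calc Nat.card (H ⊓ K : Subgroup G) * CK.relIndex CH * Nat.card CK
        ≤ Nat.card (H ⊓ K : Subgroup G) * CK.relIndex CI * Nat.card CK := by gcongr
      _ = Nat.card (H ⊓ K : Subgroup G) * Nat.card CI := by rw [← e₄]; ring
      _ ≤ _ := m₁
      _ = _ := by rw [← e₁, ← e₂]; ring
  have k₂ : Nat.card K * Nat.card CK ≤ Nat.card K * (K.relIndex H * Nat.card CS) := by gcongr
  refine ⟨fun L => (hK L).trans (k₂.trans ?_), ?_⟩
  · change _ ≤ Nat.card (H ⊔ K : Subgroup G) * Nat.card CS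
    rw [← e₃, mul_assoc]
    gcongr
  · have h := m₂.trans k₂
    rw [← e₃, mul_assoc] at h
    exact Nat.le_of_mul_le_mul_right (Nat.le_of_mul_le_mul_left h pK) pCS

theorem map_conj_sup_ne {K N : Subgroup G} (hK : K ∈ cdLattice G) (hKN : K < N) {g : G}
    (hg : g ∈ N) : K.map (MulAut.conj g).toMonoidHom ⊔ K ≠ N := by
  rintro rfl
  obtain ⟨-, h⟩ := sup_mem_cdLattice_and_relIndex_sup_le (map_mem_cdLattice (MulAut.conj g) hK) hK
  obtain ⟨_, ⟨y, hy, rfl⟩, hk⟩ := exists_inv_mul_mem_of_relIndex_le le_sup_left h hg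
  have hk' : g * y⁻¹ ∈ K := by
    simpa [mul_assoc] using hk
  have hgK : g ∈ K := by
    simpa using K.mul_mem hk' hy
  refine hKN.not_ge (sup_le ?_ le_rfl)
  rintro _ ⟨k, hk, rfl⟩
  exact K.mul_mem (K.mul_mem hgK hk) (K.inv_mem hgK)

theorem exists_lt_normal_subgroupOf_of_mem_cdLattice {A N : Subgroup G} (hA : A ∈ cdLattice G)
    (hAN : A < N) :
    ∃ K ∈ cdLattice G, A ≤ K ∧ K < N ∧ (K.subgroupOf N).Normal := by
  obtain ⟨K, ⟨hK, hAK, hKN⟩, hmax⟩ := (Set.toFinite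
    {K : Subgroup G | K ∈ cdLattice G ∧ A ≤ K ∧ K < N}).exists_maximal ⟨A, hA, le_rfl, hAN⟩
  refine ⟨K, hK, hAK, hKN, (normal_subgroupOf_iff hKN.le).2 fun k g hk hg => ?_⟩
  have hle : K.map (MulAut.conj g).toMonoidHom ≤ N := by
    rintro _ ⟨k, hk, rfl⟩
    exact N.mul_mem (N.mul_mem hg (hKN.le hk)) (N.inv_mem hg)
  refine hmax ⟨(sup_mem_cdLattice_and_relIndex_sup_le (map_mem_cdLattice (MulAut.conj g) hK)
    hK).1, hAK.trans le_sup_right, lt_of_le_of_ne (sup_le hle hKN.le)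
    (map_conj_sup_ne hK hKN hg)⟩ le_sup_right (le_sup_left (a := K.map _) ⟨k, hk, rfl⟩)

theorem isSubnormal_of_mem_cdLattice (htop : ⊤ ∈ cdLattice G) {A : Subgroup G}
    (hA : A ∈ cdLattice G) : A.IsSubnormal := by
  suffices h : ∀ N ∈ cdLattice G, A ≤ N → N.IsSubnormal → A.IsSubnormal from
    h ⊤ htop le_top .top
  intro N
  induction N using WellFoundedLT.induction with
  | ind N ih =>
    intro hN hAN hsub
    obtain rfl | hlt := hAN.eq_or_lt
    · exact hsub
    · obtain ⟨K, hK, hAK, hKN, hn⟩ := exists_lt_normal_subgroupOf_of_mem_cdLattice hA hlt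
      exact ih K hKN hK hAK (.step K N hKN.le hsub hn)

theorem relIndex_dvd_index_of_normal_right (P H : Subgroup G) [H.Normal] :
    P.relIndex H ∣ P.index := by
  have h₁ := card_inf_mul_relIndex H P
  have h₂ := card_inf_mul_relIndex P H
  have h₃ := card_inf_mul_relIndex (P ⊔ H) H
  have h₄ := card_inf_mul_relIndex (P ⊔ H) P
  rw [inf_eq_right.2 le_sup_right, relIndex_sup_right] at h₃
  rw [inf_eq_right.2 le_sup_left, ← h₃, ← h₁, ← h₂, inf_comm P H, mul_right_comm,
    mul_assoc, mul_assoc] at h₄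
  have h₅ : P.relIndex (P ⊔ H) = P.relIndex H := by
    refine Nat.eq_of_mul_eq_mul_left (Nat.mul_pos (Nat.card_pos (α := (H ⊓ P : Subgroup G)))
      (Nat.pos_of_ne_zero (relIndex_ne_zero_of_finite H P))) ?_
    linarith
  exact h₅ ▸ relIndex_dvd_index_of_le le_sup_left

theorem relIndex_dvd_index_of_isSubnormal (P : Subgroup G) {A : Subgroup G}
    (hA : A.IsSubnormal) : P.relIndex A ∣ P.index := by
  induction hA with
  | top => simp
  | step H K hHK _ hn ih =>
    refine dvd_trans ?_ ih
    rw [← relIndex_subgroupOf hHK]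
    exact relIndex_dvd_index_of_normal_right _ _

theorem mem_sylow_of_mem_isSubnormal {p : ℕ} [Fact p.Prime] (P : Sylow p G) {A : Subgroup G}
    (hA : A.IsSubnormal) [IsMulCommutative A] {x : G} (hx : x ∈ A) {k : ℕ}
    (hxk : x ^ p ^ k = 1) : x ∈ P := by
  have hcop : Nat.Coprime (P.relIndex A) (p ^ k) := by
    refine Nat.Coprime.pow_right _ (Nat.Coprime.symm ?_)
    rw [(Fact.out : p.Prime).coprime_iff_not_dvd]
    exact fun h => P.not_dvd_index (h.trans (relIndex_dvd_index_of_isSubnormal _ hA))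
  have hmem : x ^ P.relIndex A ∈ P := by
    have := pow_index_mem ((P : Subgroup G).subgroupOf A) ⟨x, hx⟩
    exact this
  have hdvd : orderOf x ∣ p ^ k := orderOf_dvd_of_pow_eq_one hxk
  obtain ⟨m, hm⟩ := exists_pow_eq_self_of_coprime (hcop.coprime_dvd_right hdvd)
  rw [← hm]
  exact P.pow_mem hmem m

theorem CDMeasureConst.isNilpotent (h : CDMeasureConst G) : Group.IsNilpotent G := by
  have heq := cdMeasureConst_iff_centLattice_eq_cdLattice.1 h
  refine ((Group.isNilpotent_of_finite_tfae (G := G)).out 0 3 rfl rfl).2 fun p _ P => ⟨?_⟩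
  intro x hx g
  obtain ⟨k, hk⟩ := P.isPGroup' ⟨x, hx⟩
  have hk' : x ^ p ^ k = 1 := congrArg Subtype.val hk
  set y := g * x * g⁻¹ with hy
  have hsub : (centralizer (centralizer (zpowers y : Set G) : Set G)).IsSubnormal :=
    isSubnormal_of_mem_cdLattice (heq ▸ top_mem_centLattice) (heq ▸ ⟨_, rfl⟩)
  have := isMulCommutative_centralizer_centralizer (zpowers y)
  refine mem_sylow_of_mem_isSubnormal P hsub (le_centralizer_centralizer _ (mem_zpowers y))
    (k := k) ?_
  rw [hy, conj_pow, hk', mul_one, mul_inv_cancel]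

end General

section Pi

variable {ι : Type*} {G : ι → Type*} [∀ i, Group (G i)]

theorem centralizer_eq_pi (H : Subgroup (∀ i, G i)) :
    centralizer (H : Set (∀ i, G i)) =
      Subgroup.pi Set.univ fun i => centralizer (H.map (Pi.evalMonoidHom G i) : Set (G i)) := by
  ext f
  simp only [mem_centralizer_iff, Subgroup.mem_pi, coe_map, Set.forall_mem_image,
    Pi.evalMonoidHom_apply, Set.mem_univ, forall_const, funext_iff, Pi.mul_apply, SetLike.mem_coe]
  exact ⟨fun h i g hg => h g hg i, fun h g hg i => h i hg⟩

theorem map_evalMonoidHom_pi (H : ∀ i, Subgroup (G i)) (i : ι) :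
    (Subgroup.pi Set.univ H).map (Pi.evalMonoidHom G i) = H i := by
  classical
  refine le_antisymm ?_ fun x hx => ⟨Pi.mulSingle i x, fun j _ => ?_, by simp⟩
  · rintro _ ⟨f, hf, rfl⟩
    exact hf i trivial
  · obtain rfl | hj := eq_or_ne j i
    · simpa using hx
    · simp [hj]

theorem centralizer_pi (H : ∀ i, Subgroup (G i)) :
    centralizer (Subgroup.pi Set.univ H : Set (∀ i, G i)) =
      Subgroup.pi Set.univ fun i => centralizer (H i : Set (G i)) := by
  simp_rw [centralizer_eq_pi, map_evalMonoidHom_pi]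

variable [Fintype ι]

theorem card_pi_univ (H : ∀ i, Subgroup (G i)) :
    Nat.card (Subgroup.pi Set.univ H) = ∏ i, Nat.card (H i) := by
  rw [← Nat.card_pi]
  exact Nat.card_congr (Equiv.Set.univPi fun i => (H i : Set (G i)))

theorem cdMeasure_pi (H : ∀ i, Subgroup (G i)) :
    cdMeasure (∀ i, G i) (Subgroup.pi Set.univ H) = ∏ i, cdMeasure (G i) (H i) := by
  unfold cdMeasure
  rw [centralizer_pi, card_pi_univ, card_pi_univ, Finset.prod_mul_distrib]

theorem cdMeasure_pi_top :
    cdMeasure (∀ i, G i) ⊤ = ∏ i, cdMeasure (G i) ⊤ := by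
  rw [← cdMeasure_pi, Subgroup.pi_top]

theorem cdMeasureConst_pi [∀ i, Finite (G i)] :
    CDMeasureConst (∀ i, G i) ↔ ∀ i, CDMeasureConst (G i) := by
  classical
  constructor
  · intro h i H
    let K : ∀ j, Subgroup (G j) := Function.update (fun _ => ⊥) i H
    have hK : K i = H := Function.update_self ..
    have h₁ := h (Subgroup.pi Set.univ K)
    rw [centralizer_pi, cdMeasure_pi, cdMeasure_pi_top,
      ← Finset.mul_prod_erase _ _ (Finset.mem_univ i),
      ← Finset.mul_prod_erase _ _ (Finset.mem_univ i), hK] at h₁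
    have h₂ : ∏ j ∈ Finset.univ.erase i, cdMeasure (G j)
        (centralizer (K j : Set (G j))) =
        ∏ j ∈ Finset.univ.erase i, cdMeasure (G j) ⊤ := by
      refine Finset.prod_congr rfl fun j hj => ?_
      have hj' : K j = ⊥ := Function.update_of_ne (Finset.ne_of_mem_erase hj) ..
      rw [hj', centralizer_eq_top_iff_subset.2]
      simp
    rw [h₂] at h₁
    exact Nat.eq_of_mul_eq_mul_right
      (Finset.prod_pos fun j _ => Nat.mul_pos Nat.card_pos Nat.card_pos) h₁
  · intro h H
    rw [centralizer_eq_pi, cdMeasure_pi, cdMeasure_pi_top]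
    exact Finset.prod_congr rfl fun i _ => h i _

end Pi

theorem cdMeasureConst_iff_sylow {G : Type*} [Group G] [Finite G] (hG : Group.IsNilpotent G) :
    CDMeasureConst G ↔ ∀ p : ℕ, p.Prime → ∀ P : Sylow p G, CDMeasureConst (P : Subgroup G) := by
  obtain ⟨e⟩ := ((Group.isNilpotent_of_finite_tfae (G := G)).out 0 4 rfl rfl).1 hG
  have hfin (p : ℕ) : Fintype (Sylow p G) := Fintype.ofFinite _
  rw [← cdMeasureConst_congr e, cdMeasureConst_pi]
  simp_rw [cdMeasureConst_pi]
  constructor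
  · intro h p hp P
    by_cases hd : p ∣ Nat.card G
    · exact h ⟨p, Nat.mem_primeFactors.2 ⟨hp, hd, Nat.card_pos.ne'⟩⟩ P
    · have := Fact.mk hp
      have hbot : Nat.card P = 1 := by
        obtain ⟨n, hn⟩ := IsPGroup.iff_card.1 P.isPGroup'
        obtain rfl | hn0 := eq_or_ne n 0
        · simpa using hn
        · exact absurd (((dvd_pow_self p hn0).trans hn.symm.dvd).trans
            (card_subgroup_dvd_card _)) hd
      have := (Nat.card_eq_one_iff_unique.1 hbot).1
      exact .of_subsingleton
  · exact fun h p P => h p (Nat.prime_of_mem_primeFactors p.2) P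

theorem cd_measure_increasing_on_centralizers_iff_nilpotent_sylow
    (G : Type*) [Group G] [Finite G] :
    (∀ C D : Subgroup G, C ∈ centLattice G → D ∈ centLattice G → C ≤ D →
        cdMeasure G C ≤ cdMeasure G D) ↔
      (Group.IsNilpotent G ∧
        ∀ (p : ℕ), p.Prime → ∀ P : Sylow p G,
          centLattice ↥(P : Subgroup G) = cdLattice ↥(P : Subgroup G)) := by
  rw [← cdMeasureConst_iff_monotoneOn_centLattice]
  simp_rw [← cdMeasureConst_iff_centLattice_eq_cdLattice]
  exact ⟨fun h => ⟨h.isNilpotent, (cdMeasureConst_iff_sylow h.isNilpotent).1 h⟩,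
    fun h => (cdMeasureConst_iff_sylow h.1).2 h.2⟩
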